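/- arXiv:1011.4897 — 6 statements merged into one kernel-verified Lean document; each statement's English description precedes it below -/
import Mathlib

section
/- Let R be a commutative ring, n ≥ 1, Λ : ℤ^n × ℤ^n → ℤ a skew-symmetric bilinear form, ε ∈ R with ε² = 0, and d, m ∈ ℤ^n. Let T be the R-linear endomorphism of the Laurent polynomial algebra R[x_1^{±1},…,x_n^{±1}] defined on monomials by T(x^a) = x^a·(1 + Λ(d,a)·ε·x^m) for all a ∈ ℤ^n. Then: (i) T is an R-algebra automorphism of R[x_1^{±1},…,x_n^{±1}], whose inverse is the map x^a ↦ x^a·(1 − Λ(d,a)·ε·x^m); (ii) D := T − id is an R-linear derivation with D ∘ D = 0, so that T = exp(D) = id + D. -/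
open AddMonoidAlgebra

/-- Let `R` be a commutative ring, `n ≥ 1`, `Λ` a skew-symmetric bilinear form on `ℤ^n`,
`ε ∈ R` with `ε² = 0`, and `d, m ∈ ℤ^n`.  Let `T` be the `R`-linear endomorphism of the
Laurent polynomial algebra `R[x_1^{±1}, …, x_n^{±1}]` (the group algebra
`AddMonoidAlgebra R (Fin n → ℤ)`) defined on monomials by
`T(x^a) = x^a · (1 + Λ(d,a)·ε·x^m)`.  Then:
(i) `T` is an `R`-algebra automorphism, whose inverse sends
    `x^a ↦ x^a · (1 − Λ(d,a)·ε·x^m)`;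
(ii) `D := T − id` is an `R`-linear derivation with `D ∘ D = 0`, so that
    `T = exp(D) = id + D`. -/
theorem laurent_twist_is_automorphism_and_exp_of_square_zero_derivation
    {R : Type*} [CommRing R] (n : ℕ) (hn : 1 ≤ n)
    (Λ : (Fin n → ℤ) →ₗ[ℤ] (Fin n → ℤ) →ₗ[ℤ] ℤ)
    (hΛ : ∀ x y, Λ x y = - Λ y x)
    (ε : R) (hε : ε ^ 2 = 0) (d m : Fin n → ℤ)
    (T : AddMonoidAlgebra R (Fin n → ℤ) →ₗ[R] AddMonoidAlgebra R (Fin n → ℤ))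
    (hT : ∀ a : Fin n → ℤ, T (single a 1) =
      single a 1 * (1 + (Λ d a • ε) • (single m 1 : AddMonoidAlgebra R (Fin n → ℤ))))
    (D : AddMonoidAlgebra R (Fin n → ℤ) →ₗ[R] AddMonoidAlgebra R (Fin n → ℤ))
    (hD : D = T - LinearMap.id) :
    (∃ E : AddMonoidAlgebra R (Fin n → ℤ) ≃ₐ[R] AddMonoidAlgebra R (Fin n → ℤ),
        (∀ f, E f = T f) ∧
        (∀ a : Fin n → ℤ, E.symm (single a 1) =
          single a 1 * (1 - (Λ d a • ε) • (single m 1 : AddMonoidAlgebra R (Fin n → ℤ))))) ∧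
    (∀ p q : AddMonoidAlgebra R (Fin n → ℤ),
        D (p * q) = D p * q + p * D q) ∧
    (D ∘ₗ D = 0) ∧
    (T = LinearMap.id + D) := by
  have hDs : ∀ (a : Fin n → ℤ) (r : R), D (single a r) = single (a + m) (r * (Λ d a • ε)) := by
    intro a r
    have h1 : (single a r : AddMonoidAlgebra R (Fin n → ℤ)) = r • single a 1 := by
      simp
    rw [h1, map_smul, hD, LinearMap.sub_apply, hT, LinearMap.id_apply, mul_add, mul_one,
      add_sub_cancel_left, mul_smul_comm, single_mul_single, smul_smul, smul_single]
    simp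
  have hεε : ε * ε = 0 := by rw [← sq]; exact hε
  have hder : ∀ p q : AddMonoidAlgebra R (Fin n → ℤ), D (p * q) = D p * q + p * D q := by
    intro p q
    induction p using AddMonoidAlgebra.induction_linear with
    | zero => simp
    | add f g hf hg => simp only [add_mul, map_add, hf, hg]; abel
    | single a r =>
      induction q using AddMonoidAlgebra.induction_linear with
      | zero => simp
      | add f g hf hg => simp only [mul_add, map_add, hf, hg]; abel
      | single b t =>
        rw [single_mul_single, hDs, hDs, hDs, single_mul_single, single_mul_single,
          show a + m + b = a + b + m by abel, show a + (b + m) = a + b + m by abel,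
          ← single_add]
        congr 1
        simp only [map_add, zsmul_eq_mul, Int.cast_add]
        ring
  have hmul0 : ∀ p q : AddMonoidAlgebra R (Fin n → ℤ), D p * D q = 0 := by
    intro p q
    induction p using AddMonoidAlgebra.induction_linear with
    | zero => simp
    | add f g hf hg => simp only [add_mul, map_add, hf, hg, add_zero]
    | single a r =>
      induction q using AddMonoidAlgebra.induction_linear with
      | zero => simp
      | add f g hf hg => simp only [mul_add, map_add, hf, hg, add_zero]
      | single b t =>
        rw [hDs, hDs, single_mul_single]
        have : r * (Λ d a • ε) * (t * (Λ d b • ε)) = 0 := by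
          simp only [zsmul_eq_mul]
          linear_combination (r * (Λ d a : R) * t * (Λ d b : R)) * hεε
        rw [this, single_zero]
  have hDD : ∀ p : AddMonoidAlgebra R (Fin n → ℤ), D (D p) = 0 := by
    intro p
    induction p using AddMonoidAlgebra.induction_linear with
    | zero => simp
    | add f g hf hg => simp only [map_add, hf, hg, add_zero]
    | single a r =>
      rw [hDs, hDs]
      have : r * (Λ d a • ε) * (Λ d (a + m) • ε) = 0 := by
        simp only [zsmul_eq_mul]
        linear_combination (r * (Λ d a : R) * (Λ d (a + m) : R)) * hεε
      rw [this, single_zero]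
  have hTD : T = LinearMap.id + D := by rw [hD]; abel
  have hTf : ∀ f, T f = f + D f := fun f => by rw [hTD]; rfl
  have hD1 : D 1 = 0 := by
    have := hder 1 1
    simpa using this
  refine ⟨⟨AlgEquiv.ofLinearEquiv
    (LinearEquiv.ofLinearMap T (LinearMap.id - D) ?_ ?_) ?_ ?_, ?_, ?_⟩, hder, ?_, hTD⟩
  · refine LinearMap.ext fun f => ?_
    simp [hTf, hDD]
  · refine LinearMap.ext fun f => ?_
    simp [hTf, hDD]
  · simp [hTf, hD1]
  · intro p q
    simp only [LinearEquiv.coe_ofLinearMap, hTf, hder]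
    linear_combination -hmul0 p q
  · intro f; rfl
  · intro a
    change (LinearMap.id - D : AddMonoidAlgebra R (Fin n → ℤ) →ₗ[R] AddMonoidAlgebra R (Fin n → ℤ))
      (single a 1) = _
    rw [LinearMap.sub_apply, hDs, LinearMap.id_apply, mul_sub, mul_one, one_mul, mul_smul_comm,
      single_mul_single, smul_single]
    simp
  · exact LinearMap.ext hDD
end

section
/- Let R be a commutative ring, n ≥ 1, Λ : ℤ^n × ℤ^n → ℤ a skew-symmetric bilinear form, ε₁, ε₂ ∈ R with ε₁² = ε₂² = 0, d₁, d₂ ∈ ℤ^n, and r₁, r₂ positive integers. Let A₁, A₂ be the R-algebra automorphisms of R[x_1^{±1},…,x_n^{±1}] defined on monomials by A_i(x^a) = x^a·(1 + Λ(d_i,a)·ε_i·x^{r_i d_i}) for all a ∈ ℤ^n. Then A₂^{-1} ∘ A₁ ∘ A₂ ∘ A₁^{-1} = C, where C is the R-algebra automorphism defined on monomials by C(x^a) = x^a·(1 + Λ(d₁,d₂)·(r₁Λ(d₁,a) + r₂Λ(d₂,a))·ε₁ε₂·x^{r₁d₁ + r₂d₂}) for all a ∈ ℤ^n. -/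
open AddMonoidAlgebra

/-- Let `R` be a commutative ring, `n ≥ 1`, `Λ` a skew-symmetric bilinear form on `ℤ^n`,
`ε₁, ε₂ ∈ R` with `ε₁² = ε₂² = 0`, `d₁, d₂ ∈ ℤ^n` and `r₁, r₂` positive integers.
Let `A₁, A₂` be the `R`-algebra automorphisms of the Laurent polynomial algebra
`R[x_1^{±1}, …, x_n^{±1}]` (the group algebra `AddMonoidAlgebra R (Fin n → ℤ)`)
defined on monomials by `A_i(x^a) = x^a · (1 + Λ(d_i,a)·ε_i·x^{r_i d_i})`.  Then
`A₂⁻¹ ∘ A₁ ∘ A₂ ∘ A₁⁻¹ = C`, where `C` is the `R`-algebra automorphism defined on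
monomials by
`C(x^a) = x^a · (1 + Λ(d₁,d₂)·(r₁Λ(d₁,a) + r₂Λ(d₂,a))·ε₁ε₂·x^{r₁d₁ + r₂d₂})`. -/
theorem laurent_commutator_formula
    {R : Type*} [CommRing R] (n : ℕ) (hn : 1 ≤ n)
    (Λ : (Fin n → ℤ) →ₗ[ℤ] (Fin n → ℤ) →ₗ[ℤ] ℤ)
    (hΛ : ∀ x y, Λ x y = - Λ y x)
    (ε₁ ε₂ : R) (hε₁ : ε₁ ^ 2 = 0) (hε₂ : ε₂ ^ 2 = 0)
    (d₁ d₂ : Fin n → ℤ) (r₁ r₂ : ℕ) (hr₁ : 0 < r₁) (hr₂ : 0 < r₂)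
    (A₁ A₂ C : AddMonoidAlgebra R (Fin n → ℤ) ≃ₐ[R] AddMonoidAlgebra R (Fin n → ℤ))
    (hA₁ : ∀ a : Fin n → ℤ, A₁ (single a 1) =
      single a 1 * (1 + (Λ d₁ a • ε₁) •
        (single ((r₁ : ℤ) • d₁) 1 : AddMonoidAlgebra R (Fin n → ℤ))))
    (hA₂ : ∀ a : Fin n → ℤ, A₂ (single a 1) =
      single a 1 * (1 + (Λ d₂ a • ε₂) •
        (single ((r₂ : ℤ) • d₂) 1 : AddMonoidAlgebra R (Fin n → ℤ))))
    (hC : ∀ a : Fin n → ℤ, C (single a 1) =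
      single a 1 * (1 + ((Λ d₁ d₂ * ((r₁ : ℤ) * Λ d₁ a + (r₂ : ℤ) * Λ d₂ a)) • (ε₁ * ε₂)) •
        (single ((r₁ : ℤ) • d₁ + (r₂ : ℤ) • d₂) 1 : AddMonoidAlgebra R (Fin n → ℤ)))) :
    ((A₁.symm.trans A₂).trans A₁).trans A₂.symm = C := by
  have h0 : ∀ x, Λ x x = 0 := fun x => by have := hΛ x x; omega
  have hsm : ∀ (k : ℤ) (r : R) (y : AddMonoidAlgebra R (Fin n → ℤ)),
      (k • r) • y = (k : AddMonoidAlgebra R (Fin n → ℤ)) * algebraMap R _ r * y := by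
    intro k r y
    rw [Algebra.smul_def, zsmul_eq_mul, map_mul, map_intCast]
  have hX : (single ((r₁ : ℤ) • d₁ + (r₂ : ℤ) • d₂) 1 : AddMonoidAlgebra R (Fin n → ℤ)) =
      single ((r₁ : ℤ) • d₁) 1 * single ((r₂ : ℤ) • d₂) 1 := by
    rw [AddMonoidAlgebra.single_mul_single, one_mul]
  simp only [hX] at hC
  simp only [hsm, map_mul] at hA₁ hA₂ hC
  have he₁ : (algebraMap R (AddMonoidAlgebra R (Fin n → ℤ)) ε₁) ^ 2 = 0 := by
    rw [← map_pow, hε₁, map_zero]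
  have he₂ : (algebraMap R (AddMonoidAlgebra R (Fin n → ℤ)) ε₂) ^ 2 = 0 := by
    rw [← map_pow, hε₂, map_zero]
  have a11 := hA₁ ((r₁ : ℤ) • d₁)
  have a12 := hA₁ ((r₂ : ℤ) • d₂)
  have a21 := hA₂ ((r₁ : ℤ) • d₁)
  have a22 := hA₂ ((r₂ : ℤ) • d₂)
  have c1 := hC ((r₁ : ℤ) • d₁)
  have h21 : Λ d₂ d₁ = - Λ d₁ d₂ := hΛ _ _
  simp only [map_smul, h0, h21, smul_eq_mul, mul_zero, Int.cast_zero, zero_mul, add_zero,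
    mul_one, zero_add] at a11 a12 a21 a22 c1
  have key : ∀ a : Fin n → ℤ, A₁ (A₂ (single a 1)) = A₂ (C (A₁ (single a 1))) := by
    intro a
    have b1 := hA₁ a
    have b2 := hA₂ a
    have b3 := hC a
    have g1 : ∀ r, A₁ (algebraMap R _ r) = algebraMap R _ r := A₁.commutes
    have g2 : ∀ r, A₂ (algebraMap R _ r) = algebraMap R _ r := A₂.commutes
    have g3 : ∀ r, C (algebraMap R _ r) = algebraMap R _ r := C.commutes
    rw [b2, b1]
    simp only [map_mul, map_add, map_one, map_intCast, g1, g2, g3, a11, a12, a21, a22, c1, b1, b2,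
      b3]
    generalize algebraMap R (AddMonoidAlgebra R (Fin n → ℤ)) ε₁ = e₁ at *
    generalize algebraMap R (AddMonoidAlgebra R (Fin n → ℤ)) ε₂ = e₂ at *
    generalize (single ((r₁ : ℤ) • d₁) 1 : AddMonoidAlgebra R (Fin n → ℤ)) = X₁ at *
    generalize (single ((r₂ : ℤ) • d₂) 1 : AddMonoidAlgebra R (Fin n → ℤ)) = X₂ at *
    generalize (single a 1 : AddMonoidAlgebra R (Fin n → ℤ)) = Y at *
    push_cast
    clear * - he₁ he₂
    grind
  have hall : ∀ y, A₁ (A₂ y) = A₂ (C (A₁ y)) := by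
    have : (A₁.toAlgHom.comp A₂.toAlgHom) = (A₂.toAlgHom.comp (C.toAlgHom.comp A₁.toAlgHom)) := by
      apply AddMonoidAlgebra.algHom_ext
      · intro a
        exact key a
      · exact Subsingleton.elim _ _
    intro y
    exact DFunLike.congr_fun this y
  ext1 y
  simp only [AlgEquiv.trans_apply]
  rw [hall, AlgEquiv.symm_apply_apply, AlgEquiv.apply_symm_apply]
end

section
/- Let R be a commutative ring, n ≥ 1, Λ : ℤ^n × ℤ^n → ℤ a skew-symmetric bilinear form, ε₁, ε₂ ∈ R with ε₁² = ε₂² = 0, d₁, d₂ ∈ ℤ^n, and r₁, r₂ positive integers. Let A₁, A₂ be the R-algebra automorphisms of R[x_1^{±1},…,x_n^{±1}] defined on monomials by A_i(x^a) = x^a·(1 + Λ(d_i,a)·ε_i·x^{r_i d_i}) for all a ∈ ℤ^n. Then the conjugate A₂^{-1} ∘ A₁ ∘ A₂ acts on monomials by A₂^{-1} ∘ A₁ ∘ A₂ (x^a) = x^a·(1 + Λ(d₁,a)·ε₁·x^{r₁d₁})·(1 + Λ(d₁,d₂)·(r₁Λ(d₁,a) + r₂Λ(d₂,a))·ε₁ε₂·x^{r₁d₁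 + r₂d₂}) for all a ∈ ℤ^n. -/
open AddMonoidAlgebra

/-- Let `R` be a commutative ring, `n ≥ 1`, `Λ` a skew-symmetric bilinear form on `ℤ^n`,
`ε₁, ε₂ ∈ R` with `ε₁² = ε₂² = 0`, `d₁, d₂ ∈ ℤ^n` and `r₁, r₂` positive integers.
Let `A₁, A₂` be the `R`-algebra automorphisms of the Laurent polynomial algebra
`R[x_1^{±1}, …, x_n^{±1}]` (the group algebra `AddMonoidAlgebra R (Fin n → ℤ)`)
defined on monomials by `A_i(x^a) = x^a · (1 + Λ(d_i,a)·ε_i·x^{r_i d_i})`.  Then the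
conjugate `A₂⁻¹ ∘ A₁ ∘ A₂` acts on monomials by
`(A₂⁻¹ ∘ A₁ ∘ A₂)(x^a) = x^a · (1 + Λ(d₁,a)·ε₁·x^{r₁d₁})
    · (1 + Λ(d₁,d₂)·(r₁Λ(d₁,a) + r₂Λ(d₂,a))·ε₁ε₂·x^{r₁d₁ + r₂d₂})`. -/
theorem laurent_conjugate_formula
    {R : Type*} [CommRing R] (n : ℕ) (hn : 1 ≤ n)
    (Λ : (Fin n → ℤ) →ₗ[ℤ] (Fin n → ℤ) →ₗ[ℤ] ℤ)
    (hΛ : ∀ x y, Λ x y = - Λ y x)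
    (ε₁ ε₂ : R) (hε₁ : ε₁ ^ 2 = 0) (hε₂ : ε₂ ^ 2 = 0)
    (d₁ d₂ : Fin n → ℤ) (r₁ r₂ : ℕ) (hr₁ : 0 < r₁) (hr₂ : 0 < r₂)
    (A₁ A₂ : AddMonoidAlgebra R (Fin n → ℤ) ≃ₐ[R] AddMonoidAlgebra R (Fin n → ℤ))
    (hA₁ : ∀ a : Fin n → ℤ, A₁ (single a 1) =
      single a 1 * (1 + (Λ d₁ a • ε₁) •
        (single ((r₁ : ℤ) • d₁) 1 : AddMonoidAlgebra R (Fin n → ℤ))))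
    (hA₂ : ∀ a : Fin n → ℤ, A₂ (single a 1) =
      single a 1 * (1 + (Λ d₂ a • ε₂) •
        (single ((r₂ : ℤ) • d₂) 1 : AddMonoidAlgebra R (Fin n → ℤ))))
    :
    ∀ a : Fin n → ℤ, A₂.symm (A₁ (A₂ (single a 1))) =
      single a 1 *
        (1 + (Λ d₁ a • ε₁) •
          (single ((r₁ : ℤ) • d₁) 1 : AddMonoidAlgebra R (Fin n → ℤ))) *
        (1 + ((Λ d₁ d₂ * ((r₁ : ℤ) * Λ d₁ a + (r₂ : ℤ) * Λ d₂ a)) • (ε₁ * ε₂)) •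
          (single ((r₁ : ℤ) • d₁ + (r₂ : ℤ) • d₂) 1 : AddMonoidAlgebra R (Fin n → ℤ))) := by
  intro a
  rw [AlgEquiv.symm_apply_eq]
  have hs : ∀ (k : ℤ) (e : R) (z : AddMonoidAlgebra R (Fin n → ℤ)),
      (k • e) • z = (k : AddMonoidAlgebra R (Fin n → ℤ)) *
        algebraMap R (AddMonoidAlgebra R (Fin n → ℤ)) e * z := by
    intro k e z
    rw [Algebra.smul_def, map_zsmul, zsmul_eq_mul]
  have hadd : (single ((r₁ : ℤ) • d₁ + (r₂ : ℤ) • d₂) 1 : AddMonoidAlgebra R (Fin n → ℤ)) =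
      single ((r₁ : ℤ) • d₁) 1 * single ((r₂ : ℤ) • d₂) 1 := by
    rw [AddMonoidAlgebra.single_mul_single, one_mul]
  have hE₁ : (algebraMap R (AddMonoidAlgebra R (Fin n → ℤ)) ε₁) ^ 2 = 0 := by
    rw [← map_pow, hε₁, map_zero]
  have hE₂ : (algebraMap R (AddMonoidAlgebra R (Fin n → ℤ)) ε₂) ^ 2 = 0 := by
    rw [← map_pow, hε₂, map_zero]
  have hsk := hΛ d₂ d₁
  rw [hadd]
  simp only [hs] at hA₁ hA₂ ⊢
  have h1Y := hA₁ ((r₂ : ℤ) • d₂)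
  have h2X := hA₂ ((r₁ : ℤ) • d₁)
  have h2Y := hA₂ ((r₂ : ℤ) • d₂)
  rw [hA₂ a]
  simp only [map_mul, map_add, map_one, map_intCast, AlgEquiv.commutes]
  rw [hA₁ a, hA₂ a, h1Y, h2X, h2Y]
  simp only [map_smul, smul_eq_mul, hsk]
  push_cast
  generalize algebraMap R (AddMonoidAlgebra R (Fin n → ℤ)) ε₁ = E₁ at *
  generalize algebraMap R (AddMonoidAlgebra R (Fin n → ℤ)) ε₂ = E₂ at *
  generalize (single ((r₁ : ℤ) • d₁) 1 : AddMonoidAlgebra R (Fin n → ℤ)) = X at *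
  generalize (single ((r₂ : ℤ) • d₂) 1 : AddMonoidAlgebra R (Fin n → ℤ)) = Y at *
  generalize (single a 1 : AddMonoidAlgebra R (Fin n → ℤ)) = Z at *
  generalize ((Λ d₁ a : ℤ) : AddMonoidAlgebra R (Fin n → ℤ)) = l₁ at *
  generalize ((Λ d₂ a : ℤ) : AddMonoidAlgebra R (Fin n → ℤ)) = l₂ at *
  generalize ((Λ d₁ d₂ : ℤ) : AddMonoidAlgebra R (Fin n → ℤ)) = p at *
  generalize ((Λ d₂ d₂ : ℤ) : AddMonoidAlgebra R (Fin n → ℤ)) = q at *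
  generalize ((r₁ : ℕ) : AddMonoidAlgebra R (Fin n → ℤ)) = s₁ at *
  generalize ((r₂ : ℕ) : AddMonoidAlgebra R (Fin n → ℤ)) = s₂ at *
  clear hA₁ hA₂ h1Y h2X h2Y hs hadd
  grind
end

section
/- Let R be a commutative ring, n ≥ 1, Λ : ℤ^n × ℤ^n → ℤ a skew-symmetric bilinear form, ε₁, ε₂ ∈ R with ε₁² = ε₂² = 0, d₁, d₂ ∈ ℤ^n, and r₁, r₂ positive integers. Let A₁, A₂ be the R-algebra automorphisms of R[x_1^{±1},…,x_n^{±1}] defined on monomials by A_i(x^a) = x^a·(1 + Λ(d_i,a)·ε_i·x^{r_i d_i}) for all a ∈ ℤ^n. If ε₁·ε₂ = 0 or Λ(d₁,d₂) = 0, then A₁ and A₂ commute: A₁ ∘ A₂ = A₂ ∘ A₁. -/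
open AddMonoidAlgebra

/-- Let `R` be a commutative ring, `n ≥ 1`, `Λ` a skew-symmetric bilinear form on `ℤ^n`,
`ε₁, ε₂ ∈ R` with `ε₁² = ε₂² = 0`, `d₁, d₂ ∈ ℤ^n` and `r₁, r₂` positive integers.
Let `A₁, A₂` be the `R`-algebra automorphisms of the Laurent polynomial algebra
`R[x_1^{±1}, …, x_n^{±1}]` (the group algebra `AddMonoidAlgebra R (Fin n → ℤ)`)
defined on monomials by `A_i(x^a) = x^a · (1 + Λ(d_i,a)·ε_i·x^{r_i d_i})`.  If `ε₁·ε₂ = 0`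
or `Λ(d₁,d₂) = 0`, then `A₁` and `A₂` commute: `A₁ ∘ A₂ = A₂ ∘ A₁`. -/
theorem laurent_twists_commute
    {R : Type*} [CommRing R] (n : ℕ) (hn : 1 ≤ n)
    (Λ : (Fin n → ℤ) →ₗ[ℤ] (Fin n → ℤ) →ₗ[ℤ] ℤ)
    (hΛ : ∀ x y, Λ x y = - Λ y x)
    (ε₁ ε₂ : R) (hε₁ : ε₁ ^ 2 = 0) (hε₂ : ε₂ ^ 2 = 0)
    (d₁ d₂ : Fin n → ℤ) (r₁ r₂ : ℕ) (hr₁ : 0 < r₁) (hr₂ : 0 < r₂)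
    (A₁ A₂ : AddMonoidAlgebra R (Fin n → ℤ) ≃ₐ[R] AddMonoidAlgebra R (Fin n → ℤ))
    (hA₁ : ∀ a : Fin n → ℤ, A₁ (single a 1) =
      single a 1 * (1 + (Λ d₁ a • ε₁) •
        (single ((r₁ : ℤ) • d₁) 1 : AddMonoidAlgebra R (Fin n → ℤ))))
    (hA₂ : ∀ a : Fin n → ℤ, A₂ (single a 1) =
      single a 1 * (1 + (Λ d₂ a • ε₂) •
        (single ((r₂ : ℤ) • d₂) 1 : AddMonoidAlgebra R (Fin n → ℤ))))
    (h : ε₁ * ε₂ = 0 ∨ Λ d₁ d₂ = 0) :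
    A₂.trans A₁ = A₁.trans A₂ := by
  have key₁ : ε₂ * (Λ d₁ ((r₂ : ℤ) • d₂) • ε₁) = 0 := by
    rw [map_smul]
    rcases h with h | h
    · rw [mul_smul_comm, mul_comm, h, smul_zero]
    · simp [h]
  have key₂ : ε₁ * (Λ d₂ ((r₁ : ℤ) • d₁) • ε₂) = 0 := by
    rw [map_smul]
    rcases h with h | h
    · rw [mul_smul_comm, h, smul_zero]
    · simp [hΛ d₂ d₁, h]
  have e₁ : ε₂ • A₁ (single ((r₂ : ℤ) • d₂) 1) =
      ε₂ • (single ((r₂ : ℤ) • d₂) 1 : AddMonoidAlgebra R (Fin n → ℤ)) := by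
    rw [hA₁, mul_add, mul_one, smul_add, mul_smul_comm, smul_smul, key₁, zero_smul, add_zero]
  have e₂ : ε₁ • A₂ (single ((r₁ : ℤ) • d₁) 1) =
      ε₁ • (single ((r₁ : ℤ) • d₁) 1 : AddMonoidAlgebra R (Fin n → ℤ)) := by
    rw [hA₂, mul_add, mul_one, smul_add, mul_smul_comm, smul_smul, key₂, zero_smul, add_zero]
  have main : ∀ a : Fin n → ℤ, A₁ (A₂ (single a 1)) = A₂ (A₁ (single a 1)) := by
    intro a
    rw [hA₂ a, hA₁ a]
    simp only [map_mul, map_add, map_one, map_smul]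
    rw [hA₂ a, hA₁ a]
    simp only [smul_assoc]
    rw [e₁, e₂]
    ring
  apply AlgEquiv.ext
  intro f
  have hh : (A₂.trans A₁ : _ ≃ₐ[R] _).toAlgHom = (A₁.trans A₂).toAlgHom := by
    apply AddMonoidAlgebra.algHom_ext
    · intro a
      exact main a
    · exact Subsingleton.elim _ _
  exact DFunLike.congr_fun hh f
end

section
/- Let R be a commutative ring, let u_1, …, u_k ∈ R satisfy u_l² = 0 for every l, and let x ∈ R. Then 1 + (u_1 + ⋯ + u_k)·x = Π_{J} ( 1 + (−1)^{#J − 1}·(#J − 1)!·(Π_{l ∈ J} u_l)·x^{#J} ), where the product is over all nonempty subsets J of {1,…,k}. -/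
theorem aux_F {R ι : Type*} [CommRing R] [DecidableEq ι] (v : ι → R)
    (hv : ∀ l, v l ^ 2 = 0) (s : Finset ι) : ∀ n : ℕ,
    (1 + ∑ l ∈ s, v l) ^ (n + 1) *
      (∑ J ∈ s.powerset, (-1 : R) ^ J.card * ((J.card + n).factorial : R) * ∏ l ∈ J, v l)
      = (n.factorial : R) := by
  induction s using Finset.induction_on with
  | empty => intro n; simp
  | insert a s ha ih =>
    intro n
    have h1 : ∑ J ∈ s.powerset, (-1 : R) ^ (insert a J).card *
        (((insert a J).card + n).factorial : R) * ∏ l ∈ insert a J, v l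
        = - v a * ∑ J ∈ s.powerset, (-1 : R) ^ J.card *
          ((J.card + (n + 1)).factorial : R) * ∏ l ∈ J, v l := by
      rw [Finset.mul_sum]
      refine Finset.sum_congr rfl fun J hJ => ?_
      have haJ : a ∉ J := fun h => ha (Finset.mem_powerset.1 hJ h)
      rw [Finset.card_insert_of_notMem haJ, Finset.prod_insert haJ,
        show J.card + 1 + n = J.card + (n + 1) by ring]
      ring
    rw [Finset.sum_powerset_insert ha, h1, Finset.sum_insert ha]
    have e0 := ih 0
    have en := ih n
    have en1 := ih (n + 1)
    have hva := hv a
    generalize (∑ l ∈ s, v l) = S at *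
    generalize (∑ J ∈ s.powerset, (-1 : R) ^ J.card *
      ((J.card + n).factorial : R) * ∏ l ∈ J, v l) = A at *
    generalize (∑ J ∈ s.powerset, (-1 : R) ^ J.card *
      ((J.card + (n + 1)).factorial : R) * ∏ l ∈ J, v l) = B at *
    generalize (∑ J ∈ s.powerset, (-1 : R) ^ J.card *
      ((J.card + 0).factorial : R) * ∏ l ∈ J, v l) = C at *
    have hp : ∀ m : ℕ, (1 + (v a + S)) ^ (m + 1) =
        (1 + S) ^ (m + 1) + (m + 1) * (1 + S) ^ m * v a := by
      intro m
      induction m with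
      | zero => simp; ring
      | succ m ihm =>
        rw [pow_succ, ihm]
        push_cast
        linear_combination ((m : R) + 1) * (1 + S) ^ m * hva
    rw [hp]
    rw [Nat.factorial_succ] at en1
    push_cast at en1
    simp only [zero_add, pow_one, Nat.factorial_zero, Nat.cast_one] at e0
    have hb : ((n : R) + 1) * (1 + S) ^ n * A - (1 + S) ^ (n + 1) * B = 0 := by
      linear_combination (-(((n : R) + 1) * (1 + S) ^ n * A - (1 + S) ^ (n + 1) * B)) * e0
        + C * ((n : R) + 1) * en - C * en1
    linear_combination en + v a * hb - ((n : R) + 1) * (1 + S) ^ n * B * hva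

theorem aux_prod {R κ : Type*} [CommRing R] (w : R) (hw : w ^ 2 = 0)
    (T : Finset κ) (c : κ → R) : ∏ J ∈ T, (1 + w * c J) = 1 + w * ∑ J ∈ T, c J := by
  classical
  induction T using Finset.induction_on with
  | empty => simp
  | insert a s ha ih =>
    rw [Finset.prod_insert ha, Finset.sum_insert ha, ih]
    linear_combination c a * (∑ J ∈ s, c J) * hw

theorem aux_main {R ι : Type*} [CommRing R] [DecidableEq ι] (v : ι → R)
    (hv : ∀ l, v l ^ 2 = 0) (s : Finset ι) :
    ∏ J ∈ s.powerset, (if J.Nonempty then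
      (1 + (-1 : R) ^ (J.card - 1) * ((J.card - 1).factorial : R) * ∏ l ∈ J, v l) else 1)
      = 1 + ∑ l ∈ s, v l := by
  induction s using Finset.induction_on with
  | empty => simp
  | insert a s ha ih =>
    rw [Finset.prod_powerset_insert ha, ih, Finset.sum_insert ha]
    have h1 : ∀ J ∈ s.powerset, (if (insert a J).Nonempty then
      (1 + (-1 : R) ^ ((insert a J).card - 1) * (((insert a J).card - 1).factorial : R) *
        ∏ l ∈ insert a J, v l) else 1) =
        1 + v a * ((-1 : R) ^ J.card * ((J.card + 0).factorial : R) * ∏ l ∈ J, v l) := by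
      intro J hJ
      have haJ : a ∉ J := fun h => ha (Finset.mem_powerset.1 hJ h)
      rw [if_pos (Finset.insert_nonempty a J), Finset.card_insert_of_notMem haJ,
        Finset.prod_insert haJ]
      simp only [Nat.add_sub_cancel, add_zero]
      ring
    rw [Finset.prod_congr rfl h1, aux_prod _ (hv a)]
    have e0 := aux_F v hv s 0
    simp only [zero_add, pow_one, Nat.factorial_zero, Nat.cast_one] at e0
    linear_combination v a * e0

/-- Let `R` be a commutative ring, let `u_1, …, u_k ∈ R` satisfy `u_l² = 0` for every
`l`, and let `x ∈ R`.  Then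
`1 + (u_1 + ⋯ + u_k)·x = Π_J (1 + (−1)^{#J−1}·(#J−1)!·(Π_{l ∈ J} u_l)·x^{#J})`,
the product being over all nonempty subsets `J` of `{1,…,k}`. -/
theorem one_add_sum_mul_factorization {R : Type*} [CommRing R] (k : ℕ) (u : Fin k → R)
    (hu : ∀ l, u l ^ 2 = 0) (x : R) :
    1 + (∑ l, u l) * x =
      ∏ J ∈ (Finset.univ : Finset (Fin k)).powerset.filter (fun J => J.Nonempty),
        (1 + (-1 : R) ^ (J.card - 1) * ((J.card - 1).factorial : R) *
          (∏ l ∈ J, u l) * x ^ J.card) := by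
  have h := aux_main (fun l => u l * x) (fun l => by rw [mul_pow, hu, zero_mul]) Finset.univ
  rw [Finset.sum_mul, ← h, Finset.prod_filter]
  refine Finset.prod_congr rfl fun J _ => ?_
  rw [Finset.prod_mul_distrib, Finset.prod_const, mul_assoc _ _ (x ^ J.card)]
end

section
/- Let Q be a finite quiver whose underlying undirected graph is a tree (connected and without unoriented cycles), such that every vertex is either a sink (no outgoing arrows) or a source (no incoming arrows and at least one outgoing arrow), and such that every vertex of degree at most 1 in the underlying graph is a sink. Let S be the number of sources of Q. Define subsets X_0 ⊆ X_1 ⊆ X_2 ⊆ … of the set of sources recursively by X_0 = ∅ and X_{n+1} = X_n ∪ { i a source : there exists an arrow i → j such that every source i' ≠ i with an arrow i' → j belongs to X_n }. Then X_S contains every source of Q. -/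
theorem tree_parent_unique {V : Type*} {G : SimpleGraph V} (hG : G.IsTree) (r : V) {u v w : V}
    (hu : G.Adj u w) (hv : G.Adj v w) (h1 : G.dist r w = G.dist r u + 1)
    (h2 : G.dist r w = G.dist r v + 1) : u = v := by
  obtain ⟨p, hp⟩ := hG.connected.exists_walk_length_eq_dist r u
  obtain ⟨q, hq⟩ := hG.connected.exists_walk_length_eq_dist r v
  have e1 : (p.concat hu).IsPath :=
    SimpleGraph.Walk.isPath_of_length_eq_dist _ (by rw [SimpleGraph.Walk.length_concat]; omega)
  have e2 : (q.concat hv).IsPath :=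
    SimpleGraph.Walk.isPath_of_length_eq_dist _ (by rw [SimpleGraph.Walk.length_concat]; omega)
  have e := (hG.existsUnique_path r w).unique e1 e2
  have := congrArg SimpleGraph.Walk.penultimate e
  simpa using this

/-- Let `Q` be a finite quiver (with arrow relation `Arr`) whose underlying undirected
graph `G` is a tree, such that every vertex is either a sink (no outgoing arrows) or a
source (no incoming arrows and at least one outgoing arrow), and such that every vertex
of degree at most 1 in the underlying graph (at most one neighbour) is a sink.  Let `S`
be the number of sources.  Define `X_0 = ∅` and
`X_{n+1} = X_n ∪ { i a source : ∃ arrow i → j such that every source i' ≠ i with an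
arrow i' → j belongs to X_n }`.  Then `X_S` contains every source. -/
theorem sources_reached_in_card_sources_steps
    {V : Type*} [Fintype V] (Arr : V → V → Prop)
    (IsSink IsSource : V → Prop)
    (hSinkDef : ∀ v, IsSink v ↔ ∀ w, ¬ Arr v w)
    (hSourceDef : ∀ v, IsSource v ↔ ((∀ w, ¬ Arr w v) ∧ ∃ w, Arr v w))
    (G : SimpleGraph V)
    (hGAdj : ∀ u v, G.Adj u v ↔ (u ≠ v ∧ (Arr u v ∨ Arr v u)))
    (hTree : G.IsTree)
    (hSinkOrSource : ∀ v, IsSink v ∨ IsSource v)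
    (hBoundary : ∀ v, (∀ w w', G.Adj v w → G.Adj v w' → w = w') → IsSink v)
    (X : ℕ → Set V)
    (hX0 : X 0 = ∅)
    (hXsucc : ∀ n, X (n + 1) =
      X n ∪ {i | IsSource i ∧ ∃ j, Arr i j ∧
        ∀ i', IsSource i' → i' ≠ i → Arr i' j → i' ∈ X n}) :
    ∀ i, IsSource i → i ∈ X (Nat.card {v : V // IsSource v}) := by
  classical
  have hadj : ∀ i j, IsSource i → Arr i j → G.Adj i j := by
    intro i j hi hij
    refine (hGAdj i j).2 ⟨?_, Or.inl hij⟩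
    rintro rfl
    exact ((hSourceDef i).1 hi).1 i hij
  have harr : ∀ i j, IsSource i → G.Adj i j → Arr i j := by
    intro i j hi hij
    rcases ((hGAdj i j).1 hij).2 with h | h
    · exact h
    · exact absurd h (((hSourceDef i).1 hi).1 j)
  have hsub : ∀ n, X n ⊆ {v | IsSource v} := by
    intro n
    induction n with
    | zero => simp [hX0]
    | succ n ih =>
      rw [hXsucc]
      rintro x (hx | hx)
      · exact ih hx
      · exact hx.1
  have key : ∀ n, (∃ i, IsSource i ∧ i ∉ X n) → ∃ i, i ∉ X n ∧ i ∈ X (n + 1) := by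
    rintro n ⟨r, hr, hrn⟩
    obtain ⟨i, hi, hmax⟩ := Set.exists_max_image {v | IsSource v ∧ v ∉ X n} (G.dist r)
      (Set.toFinite _) ⟨r, hr, hrn⟩
    obtain ⟨hiS, hin⟩ := hi
    have hns : ¬ IsSink i := by
      intro h
      obtain ⟨w, hw⟩ := ((hSourceDef i).1 hiS).2
      exact (hSinkDef i).1 h w hw
    have hj : ∃ j, G.Adj i j ∧ G.dist r j = G.dist r i + 1 := by
      by_contra hcon
      push Not at hcon
      refine hns (hBoundary i fun w w' hw hw' => ?_)
      have a := hTree.dist_eq_dist_add_one_of_adj r hw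
      have b := hTree.dist_eq_dist_add_one_of_adj r hw'
      exact tree_parent_unique hTree r hw.symm hw'.symm
        (a.resolve_right (hcon w hw)) (b.resolve_right (hcon w' hw'))
    obtain ⟨j, hij, hd⟩ := hj
    refine ⟨i, hin, ?_⟩
    rw [hXsucc]
    refine Or.inr ⟨hiS, j, harr i j hiS hij, fun i' hi' hne hi'j => ?_⟩
    by_contra hnot
    have hle := hmax i' ⟨hi', hnot⟩
    have ha := hadj i' j hi' hi'j
    rcases hTree.dist_eq_dist_add_one_of_adj r ha with h | h
    · omega
    · exact hne (tree_parent_unique hTree r ha hij h hd)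
  have hcard : ∀ n, (∀ i, IsSource i → i ∈ X n) ∨ n ≤ (X n).ncard := by
    intro n
    induction n with
    | zero => right; omega
    | succ n ih =>
      have hmono : X n ⊆ X (n + 1) := by
        rw [hXsucc]
        exact Set.subset_union_left
      by_cases hall : ∀ i, IsSource i → i ∈ X n
      · exact Or.inl fun i hi => hmono (hall i hi)
      · right
        have h1 := ih.resolve_left hall
        push Not at hall
        obtain ⟨i, hi1, hi2⟩ := key n hall
        have hlt : X n ⊂ X (n + 1) := ⟨hmono, fun h => hi1 (h hi2)⟩
        have := Set.ncard_lt_ncard hlt (Set.toFinite _)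
        omega
  rcases hcard (Nat.card {v : V // IsSource v}) with h | h
  · exact h
  · have heq := Set.eq_of_subset_of_ncard_le (hsub _) (t := {v | IsSource v}) h (Set.toFinite _)
    intro i hi
    rw [heq]
    exact hi
end
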